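/- The number of conjugacy classes of involutive isometries of a fixed nondegenerate integral lattice (L, q) is finite. -/

import Mathlib

/-- Minkowski's convex body theorem for the preimage of a cube under a linear map. -/
theorem exists_int_ne_zero_abs_le {ι : Type*} [Fintype ι]
    (f : (ι → ℝ) →ₗ[ℝ] (ι → ℝ)) (hf : LinearMap.det f ≠ 0) (t : ℝ) (ht : 0 ≤ t)
    (hft : |LinearMap.det f| < t ^ Fintype.card ι) :
    ∃ v : ι → ℤ, v ≠ 0 ∧ ∀ i, |f (fun j => (v j : ℝ)) i| ≤ t := by
  classical
  have fund := ZSpan.isAddFundamentalDomain' (Pi.basisFun ℝ ι) MeasureTheory.volume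
  have : Countable (Submodule.span ℤ (Set.range (Pi.basisFun ℝ ι))).toAddSubgroup :=
    inferInstanceAs (Countable (Submodule.span ℤ (Set.range (Pi.basisFun ℝ ι))))
  obtain ⟨x, hx0, hx⟩ :=
    MeasureTheory.exists_ne_zero_mem_lattice_of_measure_mul_two_pow_lt_measure
      (s := f ⁻¹' Metric.closedBall 0 t) fund (fun x hx => by simpa using hx)
      ((convex_closedBall 0 t).linear_preimage f) (by
        rw [MeasureTheory.Measure.addHaar_preimage_linearMap _ hf,
          Real.volume_pi_closedBall _ ht, ZSpan.volume_fundamentalDomain,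
          Module.finrank_fintype_fun_eq_card]
        have h1 : (Matrix.of (Pi.basisFun ℝ ι)).det = 1 := by
          rw [← Matrix.det_one (n := ι) (R := ℝ)]
          congr 1
          ext i j
          simp [Matrix.one_apply, Pi.single_apply, eq_comm]
        have h2 : (2 : ENNReal) ^ Fintype.card ι = ENNReal.ofReal (2 ^ Fintype.card ι) := by
          rw [ENNReal.ofReal_pow (by norm_num)]; simp
        rw [h1, abs_one, ENNReal.ofReal_one, one_mul, h2, ← ENNReal.ofReal_mul (abs_nonneg _)]
        have hpos : 0 < |LinearMap.det f| := abs_pos.2 hf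
        rw [ENNReal.ofReal_lt_ofReal_iff_of_nonneg (by positivity), mul_pow, abs_inv,
          inv_mul_eq_div, lt_div_iff₀ hpos]
        gcongr)
  obtain ⟨x, hxL⟩ := x
  rw [Submodule.mem_toAddSubgroup, Module.Basis.mem_span_iff_repr_mem] at hxL
  choose v hv using hxL
  have hxv : x = fun j => (v j : ℝ) := by
    ext j; simpa using (hv j).symm
  subst hxv
  refine ⟨v, ?_, fun i => ?_⟩
  · rintro rfl
    exact hx0 (Subtype.ext (by ext; simp))
  · have h : ‖f (fun j => (v j : ℝ))‖ ≤ t := by simpa using hx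
    exact (norm_le_pi_norm (f fun j => (v j : ℝ)) i).trans h

open Matrix in
/-- A nondegenerate integral quadratic form takes a small value at some nonzero integer vector,
with a bound depending only on the rank and the determinant. -/
theorem Matrix.exists_int_ne_zero_abs_dotProduct_le {ι : Type*} [Fintype ι] [DecidableEq ι]
    [Nonempty ι] (G : Matrix ι ι ℤ) (hG : G.IsSymm) (hdet : G.det ≠ 0) :
    ∃ v : ι → ℤ, v ≠ 0 ∧ |v ⬝ᵥ (G *ᵥ v)| ≤ Fintype.card ι * (|G.det| + 1) ^ 2 := by
  set A : Matrix ι ι ℝ := G.map (Int.castRingHom ℝ) with hA_def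
  have hA : A.IsHermitian := by
    ext i j
    simpa [A] using hG.apply i j
  have hdetA : A.det = (G.det : ℝ) := ((Int.castRingHom ℝ).map_det G).symm
  set ev := hA.eigenvalues
  set U : Matrix ι ι ℝ := (hA.eigenvectorUnitary : Matrix ι ι ℝ)
  have hU : U * star U = 1 := Unitary.mul_star_self_of_mem hA.eigenvectorUnitary.2
  have hspec : A = U * Matrix.diagonal ev * star U := by
    have := hA.spectral_theorem
    rw [Unitary.conjStarAlgAut_apply] at this
    exact this
  set P : Matrix ι ι ℝ := Matrix.diagonal (fun i => √|ev i|) * star U with hP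
  have hUdet : U.det * (star U).det = 1 := by rw [← Matrix.det_mul, hU, Matrix.det_one]
  have hUdet' : (star U).det = U.det := by
    rw [Matrix.star_eq_conjTranspose, Matrix.det_conjTranspose]; simp
  have hPdet : P.det ^ 2 = |(G.det : ℝ)| := by
    rw [hP, Matrix.det_mul, mul_pow, hUdet', pow_two U.det]
    rw [hUdet'] at hUdet
    rw [hUdet, mul_one, Matrix.det_diagonal, ← Finset.prod_pow, ← hdetA, hspec, Matrix.det_mul,
      Matrix.det_mul, Matrix.det_diagonal, hUdet', mul_right_comm, hUdet, one_mul, Finset.abs_prod]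
    exact Finset.prod_congr rfl fun i _ => Real.sq_sqrt (abs_nonneg _)
  have hGpos : 0 < |(G.det : ℝ)| := abs_pos.2 (by exact_mod_cast hdet)
  have hlt : |P.det| < |(G.det : ℝ)| + 1 := by
    apply abs_lt_of_sq_lt_sq _ (by positivity)
    nlinarith
  obtain ⟨v, hv0, hv⟩ := exists_int_ne_zero_abs_le (Matrix.toLin' P)
    (by
      rw [LinearMap.det_toLin']
      intro h
      rw [h] at hPdet
      exact hdet (by exact_mod_cast abs_eq_zero.1 (by simpa using hPdet.symm)))
    (|(G.det : ℝ)| + 1) (by positivity)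
    (by
      rw [LinearMap.det_toLin']
      exact hlt.trans_le (le_self_pow₀ (by linarith) Fintype.card_ne_zero))
  refine ⟨v, hv0, ?_⟩
  set x : ι → ℝ := fun j => (v j : ℝ) with hx
  have hq : ((v ⬝ᵥ (G *ᵥ v) : ℤ) : ℝ) = x ⬝ᵥ (A *ᵥ x) := by
    simp [dotProduct, Matrix.mulVec, x, A]
  have hq2 : x ⬝ᵥ (A *ᵥ x) = ∑ i, ev i * ((star U) *ᵥ x) i ^ 2 := by
    rw [hspec, ← Matrix.mulVec_mulVec, ← Matrix.mulVec_mulVec, Matrix.dotProduct_mulVec]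
    have : x ᵥ* U = (star U) *ᵥ x := by
      rw [Matrix.star_eq_conjTranspose, Matrix.conjTranspose_eq_transpose_of_trivial,
        Matrix.mulVec_transpose]
    rw [this, dotProduct]
    refine Finset.sum_congr rfl fun i _ => ?_
    rw [Matrix.mulVec_diagonal]; ring
  have hterm : ∀ i, |ev i * ((star U) *ᵥ x) i ^ 2| ≤ (|(G.det : ℝ)| + 1) ^ 2 := by
    intro i
    have h := hv i
    rw [Matrix.toLin'_apply, hP, ← Matrix.mulVec_mulVec, Matrix.mulVec_diagonal] at h
    have h2 := pow_le_pow_left₀ (abs_nonneg _) h 2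
    rw [sq_abs, mul_pow, Real.sq_sqrt (abs_nonneg _)] at h2
    rwa [abs_mul, abs_pow, sq_abs]
  have : |((v ⬝ᵥ (G *ᵥ v) : ℤ) : ℝ)| ≤ Fintype.card ι * (|(G.det : ℝ)| + 1) ^ 2 := by
    rw [hq, hq2]
    refine (Finset.abs_sum_le_sum_abs _ _).trans ((Finset.sum_le_sum fun i _ => hterm i).trans ?_)
    simp
  exact_mod_cast this

/-- The submodule `W` with the form `B` has dual exponent dividing `D`: every `D`-multiple of a
linear functional on `W` is represented by an element of `W`. -/
def DualExponentDvd {L : Type*} [AddCommGroup L] (B : L →ₗ[ℤ] L →ₗ[ℤ] ℤ)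
    (W : Submodule ℤ L) (D : ℤ) : Prop :=
  ∀ f : W →ₗ[ℤ] ℤ, ∃ y ∈ W, ∀ x : W, B x y = D * f x

theorem exists_eq_smul_primitive {ι : Type*} [Fintype ι] (v : ι → ℤ) (hv : v ≠ 0) :
    ∃ (g : ℤ) (w k : ι → ℤ), g ≠ 0 ∧ v = g • w ∧ ∑ i, k i * w i = 1 := by
  obtain ⟨i, hi⟩ := Function.ne_iff.1 hv
  obtain ⟨w, hw, hw1⟩ := Finset.extract_gcd v (s := Finset.univ) ⟨i, Finset.mem_univ i⟩
  obtain ⟨k, hk⟩ := Finset.gcd_eq_sum_mul .univ w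
  refine ⟨Finset.univ.gcd v, w, k, ?_, ?_, ?_⟩
  · exact Finset.gcd_ne_zero_iff.2 ⟨i, Finset.mem_univ i, by simpa using hi⟩
  · ext j; simpa using hw j (Finset.mem_univ j)
  · rw [← hw1, hk]
    exact Finset.sum_congr rfl fun _ _ => by ring

/-- A form of bounded rank and bounded dual exponent takes a small nonzero value. -/
theorem exists_apply_self_ne_zero_abs_le {M : Type*} [AddCommGroup M]
    [Module.Free ℤ M] [Module.Finite ℤ M] (B : M →ₗ[ℤ] M →ₗ[ℤ] ℤ)
    (hsymm : ∀ x y, B x y = B y x) {D : ℤ} (hD : 0 < D)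
    (hdual : ∀ f : M →ₗ[ℤ] ℤ, ∃ y, ∀ x, B x y = D * f x)
    {N : ℕ} (hpos : 0 < Module.finrank ℤ M) (hN : Module.finrank ℤ M ≤ N) :
    ∃ u, B u u ≠ 0 ∧ |B u u| ≤ N * (D ^ N + 1) ^ 2 + 2 * D := by
  set n := Module.finrank ℤ M with hn
  have : NeZero n := ⟨hpos.ne'⟩
  let b : Module.Basis (Fin n) ℤ M := Module.finBasis ℤ M
  let G : Matrix (Fin n) (Fin n) ℤ := Matrix.of fun i j => B (b i) (b j)
  have hGsymm : G.IsSymm := by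
    ext i j
    simp [G, hsymm]
  choose y hy using fun j => hdual (b.coord j)
  have hmul : G * Matrix.of (fun i j => b.repr (y j) i) = D • (1 : Matrix (Fin n) (Fin n) ℤ) := by
    ext i j
    have h := hy j (b i)
    rw [← b.sum_repr (y j)] at h
    simp only [map_sum, map_smul, smul_eq_mul] at h
    simp only [Matrix.mul_apply, G, Matrix.of_apply, Matrix.smul_apply, smul_eq_mul,
      Matrix.one_apply]
    rw [Finset.sum_congr rfl fun k _ => mul_comm _ _, h]
    simp [Finsupp.single_apply]
  have hdvd : G.det ∣ D ^ n := by
    have h := congrArg Matrix.det hmul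
    rw [Matrix.det_mul, Matrix.det_smul, Matrix.det_one, mul_one, Fintype.card_fin] at h
    exact Dvd.intro _ h
  have hdet : G.det ≠ 0 := by
    intro h
    rw [h, zero_dvd_iff] at hdvd
    exact (pow_pos hD n).ne' hdvd
  have hle : |G.det| ≤ D ^ N :=
    (Int.le_of_dvd (by positivity) ((abs_dvd _ _).2 hdvd)).trans (pow_le_pow_right₀ hD hN)
  obtain ⟨v, hv0, hv⟩ := G.exists_int_ne_zero_abs_dotProduct_le hGsymm hdet
  have hbound : |∑ i, ∑ j, v i * v j * B (b i) (b j)| ≤ N * (D ^ N + 1) ^ 2 := by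
    have h : ∑ i, ∑ j, v i * v j * B (b i) (b j) = dotProduct v (G.mulVec v) := by
      simp only [dotProduct, Matrix.mulVec, G, Matrix.of_apply, Finset.mul_sum]
      exact Finset.sum_congr rfl fun _ _ => Finset.sum_congr rfl fun _ _ => by ring
    rw [h]
    refine hv.trans ?_
    rw [Fintype.card_fin]
    have : (n : ℤ) ≤ N := by exact_mod_cast hN
    gcongr
  obtain ⟨g, w, k, hg, rfl, hk⟩ := exists_eq_smul_primitive v hv0
  set z := ∑ i, w i • b i with hz
  have hzz : ∑ i, ∑ j, (g • w) i * (g • w) j * B (b i) (b j) = g ^ 2 * B z z := by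
    simp only [hz, map_sum, map_smul, LinearMap.sum_apply, LinearMap.smul_apply, smul_eq_mul,
      Finset.mul_sum, Pi.smul_apply]
    rw [Finset.sum_comm]
    exact Finset.sum_congr rfl fun _ _ => Finset.sum_congr rfl fun _ _ => by ring
  rw [hzz] at hbound
  by_cases h0 : B z z = 0
  · obtain ⟨x, hx⟩ := hdual (∑ i, k i • b.coord i)
    have hzx : B z x = D := by
      rw [hx, hz]
      simp [LinearMap.sum_apply, mul_comm (w _), hk, Finsupp.single_apply]
    set t := (B x x - 1) / (2 * D)
    have hval : B (x - t • z) (x - t • z) = (B x x - 1) % (2 * D) + 1 := by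
      have := Int.emod_add_mul_ediv (B x x - 1) (2 * D)
      simp only [map_sub, map_smul, LinearMap.sub_apply, LinearMap.smul_apply, smul_eq_mul,
        h0, hsymm x z, hzx]
      linear_combination -this
    have h1 := Int.emod_nonneg (B x x - 1) (show 2 * D ≠ 0 by positivity)
    have h2 := Int.emod_lt_of_pos (B x x - 1) (show 0 < 2 * D by positivity)
    refine ⟨x - t • z, by rw [hval]; omega, ?_⟩
    rw [hval, abs_of_pos (by omega)]
    have : 0 ≤ (N : ℤ) * (D ^ N + 1) ^ 2 := by positivity
    omega
  · refine ⟨z, h0, ?_⟩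
    have hg2 : 1 ≤ g ^ 2 := by have := sq_nonneg g; have : g ^ 2 ≠ 0 := pow_ne_zero 2 hg; omega
    rw [abs_mul, abs_of_pos (by omega : 0 < g ^ 2)] at hbound
    nlinarith [abs_nonneg (B z z)]

theorem exists_apply_self_dvd {L : Type*} [AddCommGroup L]
    [Module.Free ℤ L] [Module.Finite ℤ L] (B : L →ₗ[ℤ] L →ₗ[ℤ] ℤ)
    (hsymm : ∀ x y, B x y = B y x) {D : ℤ} (hD : 0 < D) (N : ℕ) :
    ∃ C : ℤ, 0 < C ∧ ∀ W : Submodule ℤ L, W ≠ ⊥ → Module.finrank ℤ W ≤ N →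
      DualExponentDvd B W D → ∃ u ∈ W, B u u ∣ C := by
  refine ⟨((N * (D ^ N + 1) ^ 2 + 2 * D).toNat.factorial : ℕ), by positivity,
    fun W hW hN hdual => ?_⟩
  have hpos : 0 < Module.finrank ℤ W := by
    have := Submodule.nontrivial_iff_ne_bot.2 hW
    exact Module.finrank_pos
  obtain ⟨⟨u, hu⟩, h0, hle⟩ := exists_apply_self_ne_zero_abs_le (B.domRestrict₁₂ W W)
    (fun x y => hsymm x y) hD
    (fun f => by obtain ⟨y, hy, h⟩ := hdual f; exact ⟨⟨y, hy⟩, h⟩) hpos hN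
  refine ⟨u, hu, ?_⟩
  rw [LinearMap.domRestrict₁₂_apply] at h0 hle
  rw [Int.abs_eq_natAbs] at hle
  rw [← Int.natAbs_dvd]
  exact_mod_cast Nat.dvd_factorial (Int.natAbs_pos.2 h0) (by omega)

theorem DualExponentDvd.of_dvd {L : Type*} [AddCommGroup L] {B : L →ₗ[ℤ] L →ₗ[ℤ] ℤ}
    {W : Submodule ℤ L} {D D' : ℤ} (h : DualExponentDvd B W D) (hD : D ∣ D') :
    DualExponentDvd B W D' := by
  intro f
  obtain ⟨k, rfl⟩ := hD
  obtain ⟨y, hy, hyf⟩ := h (k • f)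
  refine ⟨y, hy, fun x => ?_⟩
  rw [hyf, LinearMap.smul_apply, smul_eq_mul, mul_assoc]

/-- The dual exponent of the image of a self-adjoint quasi-projection of factor `k`. -/
theorem DualExponentDvd.of_quasiProjection {L : Type*} [AddCommGroup L]
    {B : L →ₗ[ℤ] L →ₗ[ℤ] ℤ} {W W' : Submodule ℤ L} {D : ℤ} (h : DualExponentDvd B W D)
    (p : L →ₗ[ℤ] L) (k : ℤ) (hle : W' ≤ W) (hp : ∀ x ∈ W, p x ∈ W')
    (hpk : ∀ x ∈ W', p x = k • x) (hadj : ∀ x y, B (p x) y = B x (p y)) :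
    DualExponentDvd B W' (k ^ 2 * D) := by
  intro f
  obtain ⟨y, hy, hyf⟩ := h (f ∘ₗ p.restrict hp)
  refine ⟨p y, hp y hy, fun x => ?_⟩
  have hx : p.restrict hp ⟨x, hle x.2⟩ = k • x := Subtype.ext (hpk x x.2)
  have := hyf ⟨x, hle x.2⟩
  rw [LinearMap.comp_apply, hx, map_smul, smul_eq_mul] at this
  rw [← hadj, hpk x x.2, map_smul, LinearMap.smul_apply, smul_eq_mul, this]
  ring

theorem finrank_inf_ker_add_one {L : Type*} [AddCommGroup L] [Module.Free ℤ L]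
    [Module.Finite ℤ L] (W : Submodule ℤ L) (φ : L →ₗ[ℤ] ℤ) {u : L} (hu : u ∈ W)
    (hφ : φ u ≠ 0) :
    Module.finrank ℤ (W ⊓ LinearMap.ker φ : Submodule ℤ L) + 1 = Module.finrank ℤ W := by
  have h := Submodule.finrank_quotient_add_finrank (LinearMap.ker (φ.domRestrict W))
  rw [(φ.domRestrict W).quotKerEquivRange.finrank_eq] at h
  have hker : Module.finrank ℤ (LinearMap.ker (φ.domRestrict W)) =
      Module.finrank ℤ (W ⊓ LinearMap.ker φ : Submodule ℤ L) := by
    rw [LinearMap.ker_domRestrict, ← Submodule.map_comap_subtype]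
    exact (Submodule.equivSubtypeMap W _).finrank_eq
  have hrange : Module.finrank ℤ (LinearMap.range (φ.domRestrict W)) = 1 := by
    apply le_antisymm
    · simpa using Submodule.finrank_le (LinearMap.range (φ.domRestrict W))
    · have : Nontrivial (LinearMap.range (φ.domRestrict W)) :=
        Submodule.nontrivial_iff_ne_bot.2 fun hbot => hφ <| by
          have : φ.domRestrict W ⟨u, hu⟩ ∈ LinearMap.range (φ.domRestrict W) := ⟨_, rfl⟩
          rwa [hbot, Submodule.mem_bot] at this
      exact Module.finrank_pos
  omega

theorem exists_inf_eigenspace_ne_bot {L : Type*} [AddCommGroup L] (c : L →ₗ[ℤ] L)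
    (hc : c ∘ₗ c = LinearMap.id) (W : Submodule ℤ L) (hcW : ∀ x ∈ W, c x ∈ W) (hW : W ≠ ⊥) :
    ∃ ε : ℤ, ε ^ 2 = 1 ∧ W ⊓ Module.End.eigenspace c ε ≠ ⊥ := by
  obtain ⟨x, hx, hx0⟩ := Submodule.exists_mem_ne_zero_of_ne_bot hW
  have hcc : c (c x) = x := LinearMap.congr_fun hc x
  by_cases h : x + c x = 0
  · refine ⟨-1, by norm_num, (Submodule.ne_bot_iff _).2 ⟨x, ⟨hx, ?_⟩, hx0⟩⟩
    rw [SetLike.mem_coe, Module.End.mem_eigenspace_iff, neg_one_smul]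
    exact (neg_eq_of_add_eq_zero_right h).symm
  · refine ⟨1, by norm_num,
      (Submodule.ne_bot_iff _).2 ⟨x + c x, ⟨add_mem hx (hcW x hx), ?_⟩, h⟩⟩
    rw [SetLike.mem_coe, Module.End.mem_eigenspace_iff, one_smul, map_add, hcc, add_comm]

/-- An involutive isometry has an orthogonal family of eigenvectors whose norms divide an integer
independent of the isometry, and such that only zero is orthogonal to all of them. -/
theorem exists_orthogonal_eigenvectors {L : Type*} [AddCommGroup L] [Module.Free ℤ L]
    [Module.Finite ℤ L] (B : L →ₗ[ℤ] L →ₗ[ℤ] ℤ) (hsymm : ∀ x y, B x y = B y x) (n : ℕ) :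
    ∀ D : ℤ, 0 < D → ∃ N : ℤ, 0 < N ∧ ∀ c : L →ₗ[ℤ] L, c ∘ₗ c = LinearMap.id →
      (∀ x y, B (c x) (c y) = B x y) → ∀ W : Submodule ℤ L, (∀ x ∈ W, c x ∈ W) →
      Module.finrank ℤ W = n → DualExponentDvd B W D →
      ∃ (m : Fin n → L) (ε : Fin n → ℤ), (∀ i, m i ∈ W) ∧
        (∀ i j, i ≠ j → B (m i) (m j) = 0) ∧ (∀ i, B (m i) (m i) ∣ N) ∧
        (∀ i, ε i ^ 2 = 1) ∧ (∀ i, c (m i) = ε i • m i) ∧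
        ∀ x ∈ W, (∀ i, B (m i) x = 0) → x = 0 := by
  induction n with
  | zero =>
    refine fun D hD => ⟨1, one_pos, fun c hc hcB W hcW hW hdual =>
      ⟨Fin.elim0, Fin.elim0, fun i => i.elim0, fun i => i.elim0, fun i => i.elim0,
        fun i => i.elim0, fun i => i.elim0, fun x hx _ => ?_⟩⟩
    rw [Submodule.finrank_eq_zero] at hW
    rwa [hW, Submodule.mem_bot] at hx
  | succ n ih =>
    intro D hD
    obtain ⟨C, hC, hCdvd⟩ := exists_apply_self_dvd B hsymm (show 0 < 2 ^ 2 * D by omega) (n + 1)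
    obtain ⟨N, hN, hNdvd⟩ := ih (C ^ 2 * D) (by positivity)
    refine ⟨C * N, by positivity, fun c hc hcB W hcW hW hdual => ?_⟩
    have hcc : ∀ x, c (c x) = x := LinearMap.congr_fun hc
    have hadj : ∀ x y, B (c x) y = B x (c y) := fun x y => by rw [← hcB x (c y), hcc]
    have hWbot : W ≠ ⊥ := by
      rintro rfl
      simp at hW
    obtain ⟨ε, hε, hbot⟩ := exists_inf_eigenspace_ne_bot c hc W hcW hWbot
    obtain ⟨u, ⟨huW, hu⟩, hudvd⟩ := hCdvd (W ⊓ Module.End.eigenspace c ε) hbot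
      ((Submodule.finrank_mono inf_le_left).trans hW.le)
      (hdual.of_quasiProjection (LinearMap.id + ε • c) 2 inf_le_left
        (fun x hx => ⟨add_mem hx (W.smul_mem ε (hcW x hx)), by
          simp [hcc, smul_smul, ← pow_two, hε, add_comm]⟩)
        (fun x hx => by
          have := Module.End.mem_eigenspace_iff.1 hx.2
          simp [this, smul_smul, ← pow_two, hε, two_smul])
        (fun x y => by simp [hadj]))
    rw [SetLike.mem_coe, Module.End.mem_eigenspace_iff] at hu
    have hu0 : B u u ≠ 0 := fun h => by
      rw [h, zero_dvd_iff] at hudvd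
      exact hC.ne' hudvd
    obtain ⟨m, ε', hmW, hmB, hmN, hε', hcm, hm⟩ := hNdvd c hc hcB (W ⊓ LinearMap.ker (B u))
      (fun x hx => ⟨hcW x hx.1, by
        have : B u x = 0 := hx.2
        simp [← hadj, hu, this]⟩)
      (by have := finrank_inf_ker_add_one W (B u) huW hu0; omega)
      ((hdual.of_quasiProjection (B u u • LinearMap.id - (B u).smulRight u) (B u u) inf_le_left
        (fun x hx => ⟨sub_mem (W.smul_mem _ hx) (W.smul_mem _ huW), by
          simp [mul_comm]⟩)
        (fun x hx => by
          have : B u x = 0 := hx.2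
          simp [this])
        (fun x y => by simp [hsymm x u, mul_comm])).of_dvd
        (mul_dvd_mul_right (pow_dvd_pow_of_dvd hudvd 2) D))
    have hmu : ∀ i, B u (m i) = 0 := fun i => (hmW i).2
    refine ⟨Fin.cons u m, Fin.cons ε ε', Fin.cases huW fun i => (hmW i).1, ?_, ?_, ?_, ?_, ?_⟩
    · refine Fin.cases (Fin.cases (by simp) fun j _ => by simpa using hmu j)
        fun i => Fin.cases (fun _ => by simpa [hsymm _ u] using hmu i) fun j hij => ?_
      simpa using hmB i j fun h => hij (by rw [h])
    · exact Fin.cases (by simpa using hudvd.mul_right N) fun i => by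
        simpa using (hmN i).mul_left C
    · exact Fin.cases (by simpa using hε) fun i => by simpa using hε' i
    · exact Fin.cases (by simpa using hu) fun i => by simpa using hcm i
    · exact fun x hx h => hm x ⟨hx, by simpa using h 0⟩ fun i => by simpa using h i.succ

theorem exists_dualExponentDvd_top {L : Type*} [AddCommGroup L] [Module.Free ℤ L]
    [Module.Finite ℤ L] (B : L →ₗ[ℤ] L →ₗ[ℤ] ℤ) (hsymm : ∀ x y, B x y = B y x)
    (hnd : ∀ x, (∀ y, B x y = 0) → x = 0) : ∃ D : ℤ, 0 < D ∧ DualExponentDvd B ⊤ D := by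
  let b := Module.finBasis ℤ L
  let G := Matrix.of fun i j => B (b i) (b j)
  have hG : ∀ i v, B (b i) (∑ j, v j • b j) = G.mulVec v i := by
    intro i v
    simp [G, Matrix.mulVec, dotProduct, mul_comm]
  have hdet : G.det ≠ 0 := by
    intro h
    obtain ⟨v, hv0, hv⟩ := Matrix.exists_mulVec_eq_zero_iff.2 h
    apply hv0
    have hx : ∑ j, v j • b j = 0 := hnd _ fun y => by
      rw [← b.sum_repr y, map_sum]
      refine Finset.sum_eq_zero fun i _ => ?_
      rw [map_smul, hsymm, hG, hv, Pi.zero_apply, smul_zero]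
    exact funext (Fintype.linearIndependent_iff.1 b.linearIndependent v hx)
  refine ⟨|G.det|, abs_pos.2 hdet,
    DualExponentDvd.of_dvd (fun f => ?_) (self_dvd_abs G.det)⟩
  set w : Fin (Module.finrank ℤ L) → ℤ := fun i => f ⟨b i, trivial⟩
  refine ⟨∑ j, G.adjugate.mulVec w j • b j, trivial, fun x => ?_⟩
  have : B.flip (∑ j, G.adjugate.mulVec w j • b j) =
      G.det • (f ∘ₗ (Submodule.topEquiv (R := ℤ) (M := L)).symm.toLinearMap) := by
    refine b.ext fun i => ?_
    rw [LinearMap.flip_apply, hG, Matrix.mulVec_mulVec, Matrix.mul_adjugate, Matrix.smul_mulVec,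
      Matrix.one_mulVec]
    rfl
  exact LinearMap.congr_fun this (x : L)

theorem finite_setOf_submodule_smul_mem {ι : Type*} [Finite ι] {N : ℤ} (hN : 0 < N) :
    {K : Submodule ℤ (ι → ℤ) | ∀ x, N • x ∈ K}.Finite := by
  have hred : ∀ K : Submodule ℤ (ι → ℤ), (∀ x, N • x ∈ K) → ∀ x : ι → ℤ,
      (fun i => x i % N) ∈ K ↔ x ∈ K := by
    intro K hK x
    have hx : x = (fun i => x i % N) + N • fun i => x i / N := by
      ext i
      simpa using (Int.emod_add_mul_ediv (x i) N).symm
    conv_rhs => rw [hx]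
    exact (K.add_mem_iff_left (hK _)).symm
  refine Set.Finite.of_finite_image
    (f := fun K => {z : ι → Set.Ico 0 N | (fun i => (z i : ℤ)) ∈ K}) (Set.toFinite _) ?_
  intro K hK K' hK' h
  ext x
  rw [← hred K hK, ← hred K' hK']
  exact Set.ext_iff.1 h fun i => ⟨x i % N, Int.emod_nonneg _ hN.ne', Int.emod_lt_of_pos _ hN⟩

/-- An orthogonal family of eigenvectors of `c` with norms dividing `N`, such that only zero is
orthogonal to all of them. -/
structure EigenFrame {L : Type*} [AddCommGroup L] (B : L →ₗ[ℤ] L →ₗ[ℤ] ℤ) (c : L →ₗ[ℤ] L)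
    (N : ℤ) (n : ℕ) where
  vec : Fin n → L
  sign : Fin n → ℤ
  orthogonal : ∀ i j, i ≠ j → B (vec i) (vec j) = 0
  dvd : ∀ i, B (vec i) (vec i) ∣ N
  sign_sq : ∀ i, sign i ^ 2 = 1
  map_vec : ∀ i, c (vec i) = sign i • vec i
  eq_zero : ∀ x, (∀ i, B (vec i) x = 0) → x = 0

namespace EigenFrame

variable {L : Type*} [AddCommGroup L] {B : L →ₗ[ℤ] L →ₗ[ℤ] ℤ} {c c' : L →ₗ[ℤ] L} {N : ℤ} {n : ℕ}

/-- The scalar products with the vectors of a frame. -/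
def coords (F : EigenFrame B c N n) : L →ₗ[ℤ] Fin n → ℤ := LinearMap.pi fun i => B (F.vec i)

/-- The norms, signs and coordinate lattice of a frame. -/
def invariants (F : EigenFrame B c N n) :
    (Fin n → ℤ) × (Fin n → ℤ) × Submodule ℤ (Fin n → ℤ) :=
  (fun i => B (F.vec i) (F.vec i), F.sign, LinearMap.range F.coords)

theorem coords_apply (F : EigenFrame B c N n) (x : L) (i : Fin n) :
    F.coords x i = B (F.vec i) x := rfl

theorem coords_injective (F : EigenFrame B c N n) : Function.Injective F.coords :=
  (injective_iff_map_eq_zero F.coords).2 fun x hx => F.eq_zero x fun i => congrFun hx i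

theorem coords_sum (F : EigenFrame B c N n) (v : Fin n → ℤ) (i : Fin n) :
    F.coords (∑ j, v j • F.vec j) i = v i * B (F.vec i) (F.vec i) := by
  rw [coords_apply, map_sum, Finset.sum_eq_single i]
  · simp
  · intro j _ hj
    simp [F.orthogonal i j hj.symm]
  · simp

theorem smul_eq_sum (F : EigenFrame B c N n) (x : L) :
    N • x = ∑ i, (N / B (F.vec i) (F.vec i) * F.coords x i) • F.vec i := by
  apply F.coords_injective
  ext i
  rw [coords_sum, map_smul, Pi.smul_apply, smul_eq_mul, mul_right_comm,
    Int.ediv_mul_cancel (F.dvd i)]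

theorem mul_apply_eq_sum (F : EigenFrame B c N n) (x y : L) :
    N * B x y = ∑ i, N / B (F.vec i) (F.vec i) * F.coords x i * F.coords y i := by
  rw [← smul_eq_mul, ← LinearMap.smul_apply, ← map_smul, F.smul_eq_sum x]
  simp [coords_apply]

theorem smul_mem_range_coords (F : EigenFrame B c N n) (v : Fin n → ℤ) :
    N • v ∈ LinearMap.range F.coords := by
  refine ⟨∑ i, (N / B (F.vec i) (F.vec i) * v i) • F.vec i, ?_⟩
  ext i
  rw [coords_sum, Pi.smul_apply, smul_eq_mul, mul_right_comm, Int.ediv_mul_cancel (F.dvd i)]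

theorem coords_map (F : EigenFrame B c N n) (hc : c ∘ₗ c = LinearMap.id)
    (hcB : ∀ x y, B (c x) (c y) = B x y) (x : L) (i : Fin n) :
    F.coords (c x) i = F.sign i * F.coords x i := by
  have hcc : c (c x) = x := LinearMap.congr_fun hc x
  rw [coords_apply, ← hcB, hcc, F.map_vec, map_smul, LinearMap.smul_apply, smul_eq_mul,
    coords_apply]

theorem finite_range_invariants (hN : 0 < N) (B : L →ₗ[ℤ] L →ₗ[ℤ] ℤ) (n : ℕ) :
    {d | ∃ (c : L →ₗ[ℤ] L) (F : EigenFrame B c N n), F.invariants = d}.Finite := by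
  have hdvd : {a : ℤ | a ∣ N}.Finite :=
    (Set.finite_Icc (-N) N).subset fun a ha =>
      abs_le.1 (Int.le_of_dvd hN ((abs_dvd a N).2 ha))
  have hsign : {a : ℤ | a ^ 2 = 1}.Finite :=
    (Set.finite_Icc (-1) 1).subset fun a (ha : a ^ 2 = 1) =>
      ⟨by nlinarith, by nlinarith⟩
  refine ((Set.Finite.pi' fun _ : Fin n => hdvd).prod
    ((Set.Finite.pi' fun _ : Fin n => hsign).prod
      (finite_setOf_submodule_smul_mem (ι := Fin n) hN))).subset ?_
  rintro _ ⟨c, F, rfl⟩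
  exact ⟨F.dvd, F.sign_sq, F.smul_mem_range_coords⟩

theorem exists_conj_of_invariants_eq (hN : 0 < N) (F : EigenFrame B c N n)
    (F' : EigenFrame B c' N n) (hc : c ∘ₗ c = LinearMap.id)
    (hcB : ∀ x y, B (c x) (c y) = B x y) (hc' : c' ∘ₗ c' = LinearMap.id)
    (hcB' : ∀ x y, B (c' x) (c' y) = B x y) (h : F'.invariants = F.invariants) :
    ∃ g : L ≃ₗ[ℤ] L, (∀ x y, B (g x) (g y) = B x y) ∧
      c = g.toLinearMap ∘ₗ c' ∘ₗ g.symm.toLinearMap := by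
  simp only [invariants, Prod.mk.injEq] at h
  obtain ⟨hnorm, hsign, hrange⟩ := h
  let g : L ≃ₗ[ℤ] L := (LinearEquiv.ofInjective F'.coords F'.coords_injective).trans
    ((LinearEquiv.ofEq _ _ hrange).trans
      (LinearEquiv.ofInjective F.coords F.coords_injective).symm)
  have hg : ∀ x, F.coords (g x) = F'.coords x := fun x =>
    congrArg Subtype.val ((LinearEquiv.ofInjective F.coords F.coords_injective).apply_symm_apply
      (LinearEquiv.ofEq _ _ hrange (LinearEquiv.ofInjective F'.coords F'.coords_injective x)))
  refine ⟨g, fun x y => ?_, ?_⟩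
  · apply mul_left_cancel₀ hN.ne'
    rw [F.mul_apply_eq_sum, F'.mul_apply_eq_sum, hg, hg]
    exact Finset.sum_congr rfl fun i _ => by rw [congrFun hnorm i]
  · ext x
    obtain ⟨x, rfl⟩ := g.surjective x
    apply F.coords_injective
    ext i
    simp only [LinearMap.comp_apply, LinearEquiv.coe_coe, LinearEquiv.symm_apply_apply]
    rw [F.coords_map hc hcB, hg, hg, F'.coords_map hc' hcB', hsign]

end EigenFrame

theorem stmt15 (L : Type*) [AddCommGroup L] [Module ℤ L]
    [Module.Free ℤ L] [Module.Finite ℤ L]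
    (B : L →ₗ[ℤ] L →ₗ[ℤ] ℤ)
    (hsymm : ∀ x y, B x y = B y x)
    (hnd : ∀ x, (∀ y, B x y = 0) → x = 0) :
    ∃ S : Set (L →ₗ[ℤ] L), S.Finite ∧
      ∀ c : L →ₗ[ℤ] L, c ∘ₗ c = LinearMap.id →
        (∀ x y, B (c x) (c y) = B x y) →
        ∃ c' ∈ S, ∃ g : L ≃ₗ[ℤ] L,
          (∀ x y, B (g x) (g y) = B x y) ∧
          c = g.toLinearMap ∘ₗ c' ∘ₗ g.symm.toLinearMap := by
  obtain rfl : ‹Module ℤ L› = AddCommGroup.toIntModule L := Subsingleton.elim _ _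
  obtain ⟨D, hD, hdual⟩ := exists_dualExponentDvd_top B hsymm hnd
  obtain ⟨N, hN, hframe⟩ :=
    exists_orthogonal_eigenvectors B hsymm (Module.finrank ℤ L) D hD
  let T : Set (L →ₗ[ℤ] L) :=
    {c | c ∘ₗ c = LinearMap.id ∧ ∀ x y, B (c x) (c y) = B x y}
  have hF : ∀ c : T, Nonempty (EigenFrame B c.1 N (Module.finrank ℤ L)) := by
    rintro ⟨c, hc, hcB⟩
    obtain ⟨m, ε, -, horth, hdvd, hε, hm, h0⟩ :=
      hframe c hc hcB ⊤ (fun _ _ => trivial) (finrank_top ℤ L) hdual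
    exact ⟨⟨m, ε, horth, hdvd, hε, hm, fun x => h0 x trivial⟩⟩
  let F := fun c => (hF c).some
  obtain ⟨S, -, hS⟩ := Set.exists_subset_bijOn Set.univ fun c => (F c).invariants
  have hSfin : S.Finite := hS.finite_iff_finite.2 <|
    (EigenFrame.finite_range_invariants hN B _).subset <| by
      rintro _ ⟨c, -, rfl⟩
      exact ⟨c, F c, rfl⟩
  refine ⟨Subtype.val '' S, hSfin.image _, fun c hc hcB => ?_⟩
  obtain ⟨c', hc'S, hc'⟩ := hS.surjOn ⟨⟨c, hc, hcB⟩, trivial, rfl⟩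
  exact ⟨c', ⟨c', hc'S, rfl⟩,
    EigenFrame.exists_conj_of_invariants_eq hN (F ⟨c, hc, hcB⟩) (F c') hc hcB c'.2.1 c'.2.2 hc'⟩
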